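/- arXiv:math/0608132 — 2 statements merged into one kernel-verified Lean document; each statement's English description precedes it below -/
import Mathlib

section
/- The dual parameter p̂(p) = p·ζ(p)^{σ−1} satisfies lim_{p → (1/σ)⁺} (1/σ − p̂(p))/(p − 1/σ) = 1; that is, p_c − p̂(p) ∼ p − p_c as p ↓ p_c. -/
open Finset Filter Topology in
/-- As `z → 1`, the difference quotients at `1` of `∑ i < n, z ^ i - n * z ^ (n - 1)` and
`n - ∑ i < n, z ^ i` have the same limit, so their ratio tends to `1`. -/
theorem tendsto_geom_quotient (n : ℕ) (hn : 2 ≤ n) :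
    Tendsto (fun z : ℝ =>
      (∑ i ∈ range n, z ^ i * ∑ j ∈ range (n - 1 - i), z ^ j) /
        ∑ i ∈ range n, ∑ j ∈ range i, z ^ j) (𝓝 1) (𝓝 1) := by
  have hB : (∑ i ∈ range n, ∑ j ∈ range i, (1 : ℝ) ^ j) ≠ 0 := by
    refine ne_of_gt (sum_pos' (fun i _ => by positivity) ⟨1, by simp; omega, by simp⟩)
  have hc : ContinuousAt (fun z : ℝ =>
      (∑ i ∈ range n, z ^ i * ∑ j ∈ range (n - 1 - i), z ^ j) /
        ∑ i ∈ range n, ∑ j ∈ range i, z ^ j) 1 :=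
    ContinuousAt.div (by fun_prop) (by fun_prop) hB
  have hAB : (∑ i ∈ range n, (1 : ℝ) ^ i * ∑ j ∈ range (n - 1 - i), (1 : ℝ) ^ j) =
      ∑ i ∈ range n, ∑ j ∈ range i, (1 : ℝ) ^ j := by
    simpa only [one_pow, one_mul] using
      sum_range_reflect (fun i => ∑ j ∈ range i, (1 : ℝ)) n
  have h := hc.tendsto
  rwa [hAB, div_self hB] at h

open Finset in
theorem card_sub_geom_sum (n : ℕ) (z : ℝ) :
    (n : ℝ) - ∑ i ∈ range n, z ^ i = (1 - z) * ∑ i ∈ range n, ∑ j ∈ range i, z ^ j := by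
  rw [mul_sum]
  simp [mul_neg_geom_sum]

open Finset in
theorem geom_sum_sub_card_mul_pow (n : ℕ) (z : ℝ) :
    (∑ i ∈ range n, z ^ i) - n * z ^ (n - 1) =
      (1 - z) * ∑ i ∈ range n, z ^ i * ∑ j ∈ range (n - 1 - i), z ^ j := by
  have h : ∀ i ∈ range n, (1 - z) * (z ^ i * ∑ j ∈ range (n - 1 - i), z ^ j) =
      z ^ i - z ^ (n - 1) := by
    intro i hi
    rw [mul_left_comm, mul_neg_geom_sum, mul_sub, mul_one, ← pow_add]
    congr 2
    have := mem_range.1 hi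
    omega
  rw [mul_sum, sum_congr rfl h]
  simp

open Finset in
/-- A fixed point `z ≠ 1` of `z ↦ 1 - p + p * z ^ n` satisfies `p * (1 + z + ⋯ + z ^ (n - 1)) = 1`. -/
theorem mul_geom_sum_eq_one_of_fixed {n : ℕ} {p z : ℝ} (hz : z ≠ 1)
    (h : z = 1 - p + p * z ^ n) : p * ∑ i ∈ range n, z ^ i = 1 := by
  have hz' : 1 - z ≠ 0 := sub_ne_zero.2 hz.symm
  apply mul_left_cancel₀ hz'
  rw [mul_left_comm, mul_neg_geom_sum]
  linarith

open Finset in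
theorem one_le_sum_geom_sum {n : ℕ} (hn : 2 ≤ n) {z : ℝ} (hz : 0 ≤ z) :
    1 ≤ ∑ i ∈ range n, ∑ j ∈ range i, z ^ j := by
  have h := single_le_sum (s := range n) (f := fun i => ∑ j ∈ range i, z ^ j)
    (fun i _ => by positivity) (mem_range.2 (show 1 < n by omega))
  simpa using h

open Finset in
theorem dual_quotient_eq {n : ℕ} (hn : 2 ≤ n) {p z : ℝ} (hp : 0 < p) (hz₁ : z < 1)
    (h : z = 1 - p + p * z ^ n) :
    (1 / (n : ℝ) - p * z ^ (n - 1)) / (p - 1 / (n : ℝ)) =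
      (∑ i ∈ range n, z ^ i * ∑ j ∈ range (n - 1 - i), z ^ j) /
        ∑ i ∈ range n, ∑ j ∈ range i, z ^ j := by
  have hS := mul_geom_sum_eq_one_of_fixed hz₁.ne h
  have hn' : (n : ℝ) ≠ 0 := by positivity
  have hnum : 1 / (n : ℝ) - p * z ^ (n - 1) =
      (p / n * (1 - z)) * ∑ i ∈ range n, z ^ i * ∑ j ∈ range (n - 1 - i), z ^ j := by
    rw [mul_assoc, ← geom_sum_sub_card_mul_pow, mul_sub, div_mul_eq_mul_div, hS]
    field_simp
  have hden : p - 1 / (n : ℝ) =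
      (p / n * (1 - z)) * ∑ i ∈ range n, ∑ j ∈ range i, z ^ j := by
    rw [mul_assoc, ← card_sub_geom_sum, mul_sub, div_mul_eq_mul_div, div_mul_eq_mul_div, hS]
    field_simp
  have hc : p / n * (1 - z) ≠ 0 :=
    mul_ne_zero (div_ne_zero hp.ne' hn') (sub_pos.2 hz₁).ne'
  rw [hnum, hden, mul_div_mul_left _ _ hc]

theorem sub_inv_le_of_fixed {n : ℕ} (hn : 2 ≤ n) {p z : ℝ} (hz₀ : 0 ≤ z)
    (hz₁ : z < 1) (h : z = 1 - p + p * z ^ n) : 1 - (n - p⁻¹) ≤ z := by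
  have hS := eq_inv_of_mul_eq_one_right (mul_geom_sum_eq_one_of_fixed hz₁.ne h)
  have hB := card_sub_geom_sum n z
  rw [hS] at hB
  nlinarith [one_le_sum_geom_sum hn hz₀]

/-- The dual parameter `p̂(p) = p·ζ(p)^(σ-1)` satisfies
`lim_{p → (1/σ)⁺} (1/σ - p̂(p))/(p - 1/σ) = 1`; that is, `p_c - p̂(p) ∼ p - p_c` as `p ↓ p_c`. -/
theorem stmt_4 (σ : ℕ) (hσ : 2 ≤ σ) (ζ : ℝ → ℝ)
    (hζ : ∀ p : ℝ, 1 / (σ : ℝ) < p → p ≤ 1 →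
      ζ p ∈ Set.Ico (0 : ℝ) 1 ∧ ζ p = 1 - p + p * (ζ p) ^ σ) :
    Filter.Tendsto (fun p : ℝ => (1 / (σ : ℝ) - p * (ζ p) ^ (σ - 1)) / (p - 1 / (σ : ℝ)))
      (nhdsWithin (1 / (σ : ℝ)) (Set.Ioi (1 / (σ : ℝ)))) (nhds 1) := by
  have hσ₀ : 0 < 1 / (σ : ℝ) := by positivity
  have hσ₁ : 1 / (σ : ℝ) < 1 := by
    have : (2 : ℝ) ≤ σ := by exact_mod_cast hσ
    rw [div_lt_one (by linarith)]
    linarith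
  have hmem : ∀ᶠ p in nhdsWithin (1 / (σ : ℝ)) (Set.Ioi (1 / (σ : ℝ))),
      p ∈ Set.Ioo (1 / (σ : ℝ)) 1 := Ioo_mem_nhdsGT hσ₁
  have hlow : Filter.Tendsto (fun p : ℝ => 1 - ((σ : ℝ) - p⁻¹))
      (nhdsWithin (1 / (σ : ℝ)) (Set.Ioi (1 / (σ : ℝ)))) (nhds 1) := by
    have hc : ContinuousAt (fun p : ℝ => 1 - ((σ : ℝ) - p⁻¹)) (1 / (σ : ℝ)) :=
      continuousAt_const.sub (continuousAt_const.sub (continuousAt_inv₀ hσ₀.ne'))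
    simpa using hc.tendsto.mono_left nhdsWithin_le_nhds
  have hlim : Filter.Tendsto ζ (nhdsWithin (1 / (σ : ℝ)) (Set.Ioi (1 / (σ : ℝ)))) (nhds 1) := by
    refine tendsto_of_tendsto_of_tendsto_of_le_of_le' hlow tendsto_const_nhds ?_ ?_
    · filter_upwards [hmem] with p hp
      obtain ⟨hz, h⟩ := hζ p hp.1 hp.2.le
      exact sub_inv_le_of_fixed hσ hz.1 hz.2 h
    · filter_upwards [hmem] with p hp
      exact (hζ p hp.1 hp.2.le).1.2.le
  refine ((tendsto_geom_quotient σ hσ).comp hlim).congr' ?_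
  filter_upwards [hmem] with p hp
  obtain ⟨hz, h⟩ := hζ p hp.1 hp.2.le
  exact (dual_quotient_eq hσ (hσ₀.trans hp.1) hz.2 h).symm
end

section
/- Let σ ≥ 2 be an integer, p ∈ (0, 1/σ], and τ > 0. Define g_0 = 0, g_{m+1} = p·(1 − e^{−τ}(1 − g_m)^σ), α = pσe^{−τ}, β = (σ−1)α, D = √((1−α)² + 2βp(1−e^{−τ})), C = (D + (1−α))/(D − (1−α)), and g̃(m) = (1/β)·(D·(C·e^{Dm} − 1)/(C·e^{Dm} + 1) − (1−α)). Then for every m ∈ ℕ: g̃(m) ≤ g_m ≤ g̃(m) + τ + m⁴·τ³. -/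
/-- The second Bonferroni upper bound for `(1 - x) ^ n`. -/
theorem one_sub_pow_le_quadratic {x : ℝ} (hx : 0 ≤ x) (hx1 : x ≤ 1) (n : ℕ) :
    (1 - x) ^ n ≤ 1 - n * x + n * (n - 1) / 2 * x ^ 2 := by
  induction n with
  | zero => simp
  | succ n ih =>
    have h := mul_le_mul_of_nonneg_right ih (sub_nonneg.2 hx1)
    have hn : (0 : ℝ) ≤ n * (n - 1) := by
      rcases n.eq_zero_or_pos with rfl | hn
      · simp
      · have : (1 : ℝ) ≤ n := by exact_mod_cast hn
        exact mul_nonneg (by positivity) (by linarith)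
    rw [pow_succ]
    push_cast
    nlinarith [mul_nonneg hn (pow_nonneg hx 3)]

/-- A cubic lower bound for `(1 - x) ^ n`. -/
theorem cubic_le_one_sub_pow {x : ℝ} (hx : 0 ≤ x) (hx1 : x ≤ 1) (n : ℕ) :
    1 - n * x + n * (n - 1) / 2 * x ^ 2 - n ^ 3 / 6 * x ^ 3 ≤ (1 - x) ^ n := by
  induction n with
  | zero => simp
  | succ n ih =>
    have h := mul_le_mul_of_nonneg_right ih (sub_nonneg.2 hx1)
    have hn : (0 : ℝ) ≤ n := n.cast_nonneg
    rw [pow_succ (1 - x)]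
    push_cast
    nlinarith [mul_nonneg hn (pow_nonneg hx 3), pow_nonneg hx 3,
      mul_nonneg (pow_nonneg hn 3) (pow_nonneg hx 4)]

/-- The explicit formula solves the Riccati equation with derivative `(D² - (β y + γ)²) / (2 β)`. -/
theorem hasDerivAt_riccati {β γ D C : ℝ} (hβ : 0 < β) (hC : 0 < C) {y : ℝ → ℝ}
    (hy : ∀ t, y t =
      (1 / β) * (D * (C * Real.exp (D * t) - 1) / (C * Real.exp (D * t) + 1) - γ)) (t : ℝ) :
    HasDerivAt y ((D ^ 2 - (β * y t + γ) ^ 2) / (2 * β)) t := by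
  have hE : HasDerivAt (fun t => C * Real.exp (D * t)) (C * (Real.exp (D * t) * (D * 1))) t :=
    (((hasDerivAt_id t).const_mul D).exp).const_mul C
  have hpos : C * Real.exp (D * t) + 1 ≠ 0 := by positivity
  have h := ((((hE.sub_const 1).const_mul D).div (hE.add_const 1) hpos).sub_const γ).const_mul
    (1 / β)
  rw [show y = fun t => (1 / β) *
    (D * (C * Real.exp (D * t) - 1) / (C * Real.exp (D * t) + 1) - γ) from funext hy]
  refine h.congr_deriv ?_
  field_simp
  ring

/-- The explicit solution stays in the strip where its derivative is nonnegative. -/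
theorem riccati_slope_nonneg {β γ D C : ℝ} (hβ : 0 < β) (hC : 0 < C) {y : ℝ → ℝ}
    (hy : ∀ t, y t =
      (1 / β) * (D * (C * Real.exp (D * t) - 1) / (C * Real.exp (D * t) + 1) - γ)) (t : ℝ) :
    0 ≤ (D ^ 2 - (β * y t + γ) ^ 2) / (2 * β) := by
  have hpos : C * Real.exp (D * t) + 1 ≠ 0 := by positivity
  have : (D ^ 2 - (β * y t + γ) ^ 2) / (2 * β) =
      2 * D ^ 2 * (C * Real.exp (D * t)) / (β * (C * Real.exp (D * t) + 1) ^ 2) := by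
    rw [hy]
    field_simp
    ring
  rw [this]
  positivity

/-- If `y` has derivative `f ∘ y`, with `f ∘ y` nonnegative and `f` antitone on `[0, ∞)`, the unit increments
of `y` lie between consecutive values of `f ∘ y`. -/
theorem increment_bounds_of_antitoneOn {f y : ℝ → ℝ} (hf : AntitoneOn f (Set.Ici 0))
    (hy0 : y 0 = 0) (hd : ∀ t, HasDerivAt y (f (y t)) t) (hnn : ∀ t, 0 ≤ f (y t)) (m : ℕ) :
    0 ≤ y m ∧ f (y (m + 1)) ≤ y (m + 1) - y m ∧ y (m + 1) - y m ≤ f (y m) := by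
  have hmono : Monotone y :=
    monotone_of_deriv_nonneg (fun t => (hd t).differentiableAt) fun t => by
      rw [(hd t).deriv]; exact hnn t
  have hnonneg : ∀ t, 0 ≤ t → 0 ≤ y t := fun t ht => hy0 ▸ hmono ht
  have hm : (0 : ℝ) ≤ m := m.cast_nonneg
  obtain ⟨c, hc, hcd⟩ := exists_hasDerivAt_eq_slope y (fun t => f (y t)) (lt_add_one (m : ℝ))
    (fun t _ => (hd t).continuousAt.continuousWithinAt) (fun t _ => hd t)
  simp only [add_sub_cancel_left, div_one] at hcd
  rw [← hcd]
  have hc0 := hnonneg c (hm.trans hc.1.le)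
  exact ⟨hnonneg m hm, hf hc0 (hnonneg _ (by linarith)) (hmono hc.2.le),
    hf (hnonneg m hm) hc0 (hmono hc.1.le)⟩


/-- Let `σ ≥ 2`, `p ∈ (0, 1/σ]`, `τ > 0`. Define `g 0 = 0`,
`g (m+1) = p·(1 - e^{-τ}(1 - g m)^σ)`, `α = pσe^{-τ}`, `β = (σ-1)α`,
`D = √((1-α)² + 2βp(1-e^{-τ}))`, `C = (D + (1-α))/(D - (1-α))`, and
`g̃ m = (1/β)·(D·(C·e^{Dm} - 1)/(C·e^{Dm} + 1) - (1-α))`. Then for every `m`: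
`g̃ m ≤ g m ≤ g̃ m + τ + m⁴·τ³`. -/
theorem stmt_13 (σ : ℕ) (hσ : 2 ≤ σ) (p τ : ℝ) (hp : p ∈ Set.Ioc (0 : ℝ) (1 / (σ : ℝ)))
    (hτ : 0 < τ)
    (g : ℕ → ℝ) (hg0 : g 0 = 0)
    (hgrec : ∀ m : ℕ, g (m + 1) = p * (1 - Real.exp (-τ) * (1 - g m) ^ σ))
    (α β D C : ℝ)
    (hα : α = p * (σ : ℝ) * Real.exp (-τ)) (hβ : β = ((σ : ℝ) - 1) * α)
    (hD : D = Real.sqrt ((1 - α) ^ 2 + 2 * β * p * (1 - Real.exp (-τ))))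
    (hC : C = (D + (1 - α)) / (D - (1 - α)))
    (gt : ℝ → ℝ)
    (hgt : ∀ t : ℝ, gt t =
      (1 / β) * (D * (C * Real.exp (D * t) - 1) / (C * Real.exp (D * t) + 1) - (1 - α))) :
    ∀ m : ℕ, gt m ≤ g m ∧ g m ≤ gt m + τ + (m : ℝ) ^ 4 * τ ^ 3 := by
  have hp0 : 0 < p := hp.1
  have hσ2 : (2 : ℝ) ≤ σ := by exact_mod_cast hσ
  have hpσ : p * σ ≤ 1 := (le_div_iff₀ (by linarith)).1 hp.2
  have hp1 : p ≤ 1 := by nlinarith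
  set q := Real.exp (-τ) with hq
  have hq0 : 0 < q := Real.exp_pos _
  have hq1 : q < 1 := Real.exp_lt_one_iff.2 (by linarith)
  have hqτ : 1 - q ≤ τ := by linarith [Real.add_one_le_exp (-τ)]
  have hα0 : 0 < α := by rw [hα]; positivity
  have hα1 : α ≤ 1 := by rw [hα]; nlinarith
  have hβ0 : 0 < β := by rw [hβ]; exact mul_pos (by linarith) hα0
  have ha : 0 < 2 * β * p * (1 - q) := mul_pos (by positivity) (by linarith)
  have hDsq : D ^ 2 = (1 - α) ^ 2 + 2 * β * p * (1 - q) := by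
    rw [hD, Real.sq_sqrt (by positivity)]
  have hD0 : 0 ≤ D := hD ▸ Real.sqrt_nonneg _
  have hDα : 1 - α < D := lt_of_pow_lt_pow_left₀ 2 hD0 (by linarith)
  have hDpos : 0 < D := by linarith
  have hC0 : 0 < C := by rw [hC]; exact div_pos (by linarith) (by linarith)
  have hfpoly : ∀ x : ℝ, (D ^ 2 - (β * x + (1 - α)) ^ 2) / (2 * β) =
      p * (1 - q) - (1 - α) * x - β / 2 * x ^ 2 := by
    intro x
    rw [hDsq]
    field_simp
    ring
  set f : ℝ → ℝ := fun x => p * (1 - q) - (1 - α) * x - β / 2 * x ^ 2 with hf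
  have hanti : AntitoneOn f (Set.Ici 0) := by
    intro x hx y hy hxy
    have hx : 0 ≤ x := hx
    simp only [hf]
    gcongr
  have hgt0 : gt 0 = 0 := by
    have h1 : D - (1 - α) ≠ 0 := by linarith
    have h2 : (D + (1 - α)) + (D - (1 - α)) ≠ 0 := by linarith
    have h3 : C + 1 ≠ 0 := by positivity
    rw [hgt, mul_zero, Real.exp_zero, mul_one]
    have h4 : D * (C - 1) / (C + 1) = 1 - α := by
      rw [div_eq_iff h3, hC]
      field_simp
      ring
    rw [h4]
    ring
  have hgt_nn : ∀ t, 0 ≤ f (gt t) := fun t =>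
    (riccati_slope_nonneg hβ0 hC0 hgt t).trans_eq (hfpoly _)
  have hinc := increment_bounds_of_antitoneOn hanti hgt0
    (fun t => (hasDerivAt_riccati hβ0 hC0 hgt t).congr_deriv (hfpoly _)) hgt_nn
  have hg01 : ∀ m, 0 ≤ g m ∧ g m ≤ 1 := by
    intro m
    induction m with
    | zero => simp [hg0]
    | succ m ih =>
      have h1 : 0 ≤ (1 - g m) ^ σ := pow_nonneg (by linarith) _
      have h2 : (1 - g m) ^ σ ≤ 1 := pow_le_one₀ (by linarith) (by linarith)
      rw [hgrec]
      exact ⟨mul_nonneg hp0.le (by nlinarith),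
        mul_le_one₀ hp1 (by nlinarith) (by nlinarith)⟩
  have hlower : ∀ m : ℕ, gt m ≤ g m := by
    intro m
    induction m with
    | zero => simp [hg0, hgt0]
    | succ m ih =>
      obtain ⟨h0, -, h2⟩ := hinc m
      have h3 := one_sub_pow_le_quadratic h0 (ih.trans (hg01 m).2) σ
      have h4 : (1 - g m) ^ σ ≤ (1 - gt m) ^ σ :=
        pow_le_pow_left₀ (by linarith [(hg01 m).2]) (by linarith) _
      have h5 := mul_le_mul_of_nonneg_left (h4.trans h3) (mul_pos hp0 hq0).le
      rw [hgrec]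
      push_cast
      simp only [hf, hβ, hα] at h2
      linarith
  have hlin : ∀ m : ℕ, g m ≤ m * (p * τ) := by
    intro m
    induction m with
    | zero => simp [hg0]
    | succ m ih =>
      have h1 := one_add_mul_le_pow (a := -g m) (by linarith [(hg01 m).2]) σ
      rw [← sub_eq_add_neg] at h1
      have h2 := mul_le_mul_of_nonneg_left h1 (mul_pos hp0 hq0).le
      have h3 := mul_le_mul_of_nonneg_left hqτ hp0.le
      have h4 := mul_le_mul_of_nonneg_right hα1 (hg01 m).1
      rw [hgrec]
      push_cast
      rw [hα] at h4
      linarith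
  have hcube : ∀ m : ℕ, p * q * (σ ^ 3 / 6 * g m ^ 3) ≤ (m : ℝ) ^ 3 * τ ^ 3 := by
    intro m
    have h1 : (σ * g m) ^ 3 ≤ (m * τ) ^ 3 := by
      refine pow_le_pow_left₀ (mul_nonneg (by linarith) (hg01 m).1) ?_ _
      calc σ * g m ≤ σ * (m * (p * τ)) := by gcongr; exact hlin m
        _ = (p * σ) * (m * τ) := by ring
        _ ≤ 1 * (m * τ) := by gcongr
        _ = m * τ := one_mul _
    have h2 : 0 ≤ (σ * g m) ^ 3 := pow_nonneg (mul_nonneg (by linarith) (hg01 m).1) _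
    have h3 : p * q ≤ 1 := mul_le_one₀ hp1 hq0.le hq1.le
    calc p * q * (σ ^ 3 / 6 * g m ^ 3) = p * q * ((σ * g m) ^ 3 / 6) := by ring
      _ ≤ 1 * ((σ * g m) ^ 3 / 6) := by gcongr
      _ ≤ (m * τ) ^ 3 := by linarith
      _ = _ := by ring
  have hupper : ∀ m : ℕ, g m ≤ gt m + (f 0 - f (gt m)) + (m : ℝ) ^ 4 * τ ^ 3 := by
    intro m
    induction m with
    | zero => simp [hg0, hgt0]
    | succ m ih =>
      obtain ⟨h0, h1, -⟩ := hinc m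
      have h2 := cubic_le_one_sub_pow (hg01 m).1 (hg01 m).2 σ
      have h3 := mul_le_mul_of_nonneg_left h2 (mul_pos hp0 hq0).le
      have h4 : f (g m) ≤ f (gt m) := hanti h0 (hg01 m).1 (hlower m)
      have h5 : g (m + 1) ≤ g m + f (g m) + p * q * (σ ^ 3 / 6 * g m ^ 3) := by
        rw [hgrec]
        simp only [hf, hβ, hα]
        linarith
      have h6 : (m : ℝ) ^ 4 + m ^ 3 ≤ (m + 1) ^ 4 := by
        have hm : (0 : ℝ) ≤ m := m.cast_nonneg
        nlinarith [pow_nonneg hm 3, pow_nonneg hm 2]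
      have h7 := mul_le_mul_of_nonneg_right h6 (pow_pos hτ 3).le
      push_cast
      linarith [hcube m]
  intro m
  have hf0 : f 0 ≤ τ := by
    simp only [hf]
    nlinarith
  exact ⟨hlower m, by linarith [hupper m, hgt_nn m]⟩
end
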